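/- arXiv:1712.05888 — 5 statements merged into one kernel-verified Lean document; each statement's English description precedes it below -/
import Mathlib

section
/- Sequential composition for one-sided differential privacy: let M₁, …, M_k be mechanisms such that M_i satisfies (P_i, ε_i)-one-sided differential privacy, and let P_mr be the minimum relaxation of P₁, …, P_k, defined by P_mr(r) = max(P₁(r), …, P_k(r)) for every record r. Then the composed mechanism M_C that, on input database D, runs each M_i on D independently and releases the tuple of all k outputs, satisfies (P_mr, ε₁ + ⋯ + ε_k)-one-sided differential privacy. -/
open MeasureTheory Real

/-- `D'` is a one-sided `P`-neighbor of `D`: some sensitive record `r ∈ D`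
(`P r = 0`) is replaced by a different record `r'`. -/
def OneSidedNeighbor {T : Type*} [DecidableEq T] (P : T → ℕ)
    (D D' : Multiset T) : Prop :=
  ∃ r ∈ D, P r = 0 ∧ ∃ r', r' ≠ r ∧ D' = r' ::ₘ D.erase r

/-- `(P, ε)`-one-sided differential privacy. -/
def OSDP {T : Type*} [DecidableEq T] {Ω : Type*} [MeasurableSpace Ω]
    (P : T → ℕ) (ε : ℝ) (M : Multiset T → Measure Ω) : Prop :=
  ∀ D D', OneSidedNeighbor P D D' → ∀ O : Set Ω, MeasurableSet O →
    M D O ≤ ENNReal.ofReal (Real.exp ε) * M D' O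

/-- Product measures are monotone in each factor. -/
theorem MeasureTheory.Measure.pi_le_pi {ι : Type*} [Fintype ι] {Ω : ι → Type*}
    [∀ i, MeasurableSpace (Ω i)] {μ ν : ∀ i, Measure (Ω i)} [∀ i, SigmaFinite (μ i)]
    (h : ∀ i, μ i ≤ ν i) : Measure.pi μ ≤ Measure.pi ν := by
  have hle : (Measure.pi μ).toOuterMeasure ≤
      OuterMeasure.pi fun i => (ν i).toOuterMeasure := by
    rw [OuterMeasure.le_pi]
    intro s _
    change Measure.pi μ (Set.univ.pi s) ≤ ∏ i, ν i (s i)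
    rw [Measure.pi_pi]
    exact Finset.prod_le_prod' fun i _ => h i (s i)
  refine Measure.le_iff.2 fun s hs => ?_
  rw [Measure.pi_def ν, toMeasure_apply _ _ hs]
  exact hle s

/-- Scaling each factor scales the product measure by the product of the scalars. -/
theorem MeasureTheory.Measure.pi_smul {ι : Type*} [Fintype ι] {Ω : ι → Type*}
    [∀ i, MeasurableSpace (Ω i)] (c : ι → NNReal) (ν : ∀ i, Measure (Ω i))
    [∀ i, SigmaFinite (ν i)] :
    (Measure.pi fun i => c i • ν i) = (∏ i, c i) • Measure.pi ν := by
  refine Measure.pi_eq fun s _ => ?_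
  simp only [Measure.smul_apply, Measure.pi_pi, ENNReal.smul_def, smul_eq_mul,
    ENNReal.ofNNReal_finsetProd, Finset.prod_mul_distrib]

/-- Sequential composition: if each `Mᵢ` satisfies `(Pᵢ, εᵢ)`-OSDP
(each producing a probability distribution on its own output space), then the
mechanism that runs all the `Mᵢ` independently on the input database and
releases the tuple of their outputs (i.e. whose output distribution is the
product measure) satisfies `(P_mr, ∑ᵢ εᵢ)`-OSDP, where
`P_mr r = maxᵢ Pᵢ r` is the minimum relaxation of the `Pᵢ`. -/
theorem osdp_sequential_composition {T : Type*} [DecidableEq T] {k : ℕ}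
    {Ω : Fin k → Type*} [∀ i, MeasurableSpace (Ω i)]
    (P : Fin k → T → ℕ) (ε : Fin k → ℝ)
    (M : ∀ i, Multiset T → Measure (Ω i))
    (hprob : ∀ i D, IsProbabilityMeasure (M i D))
    (hM : ∀ i, OSDP (P i) (ε i) (M i)) :
    OSDP (fun r => Finset.univ.sup fun i => P i r) (∑ i, ε i)
      (fun D => Measure.pi fun i => M i D) := by
  rintro D D' ⟨r, hr, hPr, r', hne, rfl⟩ O -
  have hle (i : Fin k) :
      M i D ≤ (Real.exp (ε i)).toNNReal • M i (r' ::ₘ D.erase r) := by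
    have hPi : P i r = 0 :=
      Nat.eq_zero_of_le_zero (hPr ▸ Finset.le_sup (f := fun i => P i r) (Finset.mem_univ i))
    exact Measure.le_iff.2 fun s hs => hM i _ _ ⟨r, hr, hPi, r', hne, rfl⟩ s hs
  have hexp : ∏ i, (Real.exp (ε i)).toNNReal = (Real.exp (∑ i, ε i)).toNNReal := by
    rw [Real.exp_sum, Real.toNNReal_prod_of_nonneg fun i _ => (Real.exp_pos _).le]
  have hpi := Measure.pi_le_pi hle O
  rw [Measure.pi_smul, hexp] at hpi
  exact hpi
end

section
/- The Suppress algorithm with threshold τ satisfies τ-freedom from exclusion attacks. Precisely, let A be a mechanism on databases satisfying unbounded τ-differential privacy (for every database E, every record y, and every measurable output set O, e^{-τ} · Pr[A(E) ∈ O] ≤ Pr[A(E ∪ {y}) ∈ O] ≤ e^{τ} · Pr[A(E) ∈ O]), and define Suppress(D) = A(D_ns), where D_ns is the sub-multiset of non-sensitive records of D. Then for every coordinate i, every sensitive value x (P(x) = 0), every value y, every product prior θ with θ_i(x) > 0 and θ_i(y) > 0, and every output event O of positive probability, Pr_θ(r_i = x | Suppress(D) ∈ O) / Pr_θ(r_i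 = y | Suppress(D) ∈ O) ≤ e^τ · Pr_θ(r_i = x) / Pr_θ(r_i = y). -/
open MeasureTheory Real

/-- The probability, in the joint experiment that first draws the database
`D : Fin n → T` from the product prior `θ` (i.e. `Pr[D] = ∏ j, θ j (D j)`) and
then draws an output from `M D`, of the event that `D ∈ S` and the output
lands in `O`. -/
noncomputable def jointProb {T : Type*} {Ω : Type*} [MeasurableSpace Ω] {n : ℕ}
    (θ : Fin n → PMF T) (M : (Fin n → T) → Measure Ω)
    (S : Set (Fin n → T)) (O : Set Ω) : ENNReal :=
  ∑' D : Fin n → T, S.indicator (fun D => (∏ j, θ j (D j)) * M D O) D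

/-- The conditional probability `Pr_θ(D ∈ S | M(D) ∈ O)` in the joint
experiment. -/
noncomputable def condProb {T : Type*} {Ω : Type*} [MeasurableSpace Ω] {n : ℕ}
    (θ : Fin n → PMF T) (M : (Fin n → T) → Measure Ω)
    (S : Set (Fin n → T)) (O : Set Ω) : ENNReal :=
  jointProb θ M S O / jointProb θ M Set.univ O

/-- The multiset of non-sensitive records (those `r` with `P r = 1`) of the
tuple database `D : Fin n → T`. -/
def nonSensitivePart {T : Type*} {n : ℕ} (P : T → ℕ) (D : Fin n → T) :
    Multiset T :=
  (Finset.univ.val.map D).filter (fun r => P r = 1)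

/-- Databases agreeing with `x` at coordinate `i` correspond to those agreeing with `y` at `i`. -/
def updateEquiv {ι T : Type*} [DecidableEq ι] (i : ι) (x y : T) :
    {D : ι → T | D i = x} ≃ {D : ι → T | D i = y} where
  toFun D := ⟨Function.update D.1 i y, by simp⟩
  invFun D := ⟨Function.update D.1 i x, by simp⟩
  left_inv := by
    rintro ⟨D, rfl⟩
    simp
  right_inv := by
    rintro ⟨D, rfl⟩
    simp

theorem prod_apply_mul_eq_mul_prod_update {ι T R : Type*} [Fintype ι] [DecidableEq ι]
    [CommMonoid R] (f : ι → T → R) (D : ι → T) (i : ι) (y : T) :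
    (∏ j, f j (D j)) * f i y = f i (D i) * ∏ j, f j (Function.update D i y j) := by
  rw [← Finset.mul_prod_erase _ _ (Finset.mem_univ i),
    ← Finset.mul_prod_erase _ (fun j => f j (Function.update D i y j)) (Finset.mem_univ i)]
  have h : ∏ j ∈ Finset.univ.erase i, f j (Function.update D i y j) =
      ∏ j ∈ Finset.univ.erase i, f j (D j) :=
    Finset.prod_congr rfl fun j hj => by
      rw [Function.update_of_ne (Finset.ne_of_mem_erase hj)]
  rw [h, Function.update_self, mul_assoc, mul_comm _ (f i y)]

theorem nonSensitivePart_update {T : Type*} {n : ℕ} (P : T → ℕ) (D : Fin n → T) (i : Fin n)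
    (hi : P (D i) = 0) (y : T) :
    nonSensitivePart P (Function.update D i y) =
      if P y = 1 then y ::ₘ nonSensitivePart P D else nonSensitivePart P D := by
  have huniv : (Finset.univ : Finset (Fin n)).val = i ::ₘ (Finset.univ.erase i).val := by
    rw [Finset.erase_val, Multiset.cons_erase (Finset.mem_univ i)]
  have hmap : (Finset.univ.erase i).val.map (Function.update D i y) =
      (Finset.univ.erase i).val.map D :=
    Multiset.map_congr rfl fun j hj =>
      Function.update_of_ne (Finset.ne_of_mem_erase (Finset.mem_val.mp hj)) _ _
  unfold nonSensitivePart
  rw [huniv, Multiset.map_cons, Multiset.map_cons, hmap, Function.update_self,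
    Multiset.filter_cons_of_neg (a := D i) _ (by simp [hi])]
  split_ifs with hy
  · exact Multiset.filter_cons_of_pos _ hy
  · exact Multiset.filter_cons_of_neg _ hy

theorem jointProb_mul_le {T Ω : Type*} [MeasurableSpace Ω] {n : ℕ} (θ : Fin n → PMF T)
    (M : (Fin n → T) → Measure Ω) (i : Fin n) (x y : T) (O : Set Ω) (c : ENNReal)
    (h : ∀ D : Fin n → T, D i = x → M D O ≤ c * M (Function.update D i y) O) :
    jointProb θ M {D | D i = x} O * θ i y ≤ c * θ i x * jointProb θ M {D | D i = y} O := by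
  unfold jointProb
  rw [← tsum_subtype, ← tsum_subtype, ← (updateEquiv i x y).tsum_eq, ← ENNReal.tsum_mul_right,
    ← ENNReal.tsum_mul_left]
  refine ENNReal.tsum_le_tsum ?_
  rintro ⟨D, hD⟩
  have hD' : D i = x := hD
  have hprod := prod_apply_mul_eq_mul_prod_update (fun j => θ j) D i y
  calc (∏ j, θ j (D j)) * M D O * θ i y
      = ((∏ j, θ j (D j)) * θ i y) * M D O := by ring
    _ ≤ ((∏ j, θ j (D j)) * θ i y) * (c * M (Function.update D i y) O) := by
      gcongr
      exact h D hD'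
    _ = c * θ i x * ((∏ j, θ j (Function.update D i y j)) * M (Function.update D i y) O) := by
      rw [hprod, hD']
      ring

theorem ENNReal.le_ofReal_exp_mul_of_ofReal_exp_neg_mul_le {τ : ℝ} {a b : ENNReal}
    (h : ENNReal.ofReal (Real.exp (-τ)) * a ≤ b) : a ≤ ENNReal.ofReal (Real.exp τ) * b := by
  calc a = ENNReal.ofReal (Real.exp τ) * (ENNReal.ofReal (Real.exp (-τ)) * a) := by
        rw [← mul_assoc, ← ENNReal.ofReal_mul (Real.exp_pos τ).le, ← Real.exp_add]
        simp
    _ ≤ ENNReal.ofReal (Real.exp τ) * b := by gcongr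

/-- The `Suppress` algorithm with threshold `τ` — which runs an (unbounded)
`τ`-differentially private algorithm `A` on the sub-multiset of non-sensitive
records — satisfies `τ`-freedom from exclusion attacks. -/
theorem suppress_freedom_from_exclusion {T : Type*} {Ω : Type*}
    [MeasurableSpace Ω] {n : ℕ}
    (τ : ℝ) (A : Multiset T → Measure Ω)
    (hprob : ∀ E, IsProbabilityMeasure (A E))
    (hA : ∀ (E : Multiset T) (y : T) (O : Set Ω), MeasurableSet O →
      ENNReal.ofReal (Real.exp (-τ)) * A E O ≤ A (y ::ₘ E) O ∧
        A (y ::ₘ E) O ≤ ENNReal.ofReal (Real.exp τ) * A E O)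
    (P : T → ℕ) (i : Fin n) (x y : T) (hx : P x = 0)
    (θ : Fin n → PMF T) (hθx : 0 < θ i x) (hθy : 0 < θ i y)
    (O : Set Ω) (hO : MeasurableSet O)
    (hpos : 0 < jointProb θ (fun D => A (nonSensitivePart P D)) Set.univ O) :
    condProb θ (fun D => A (nonSensitivePart P D)) {D | D i = x} O /
        condProb θ (fun D => A (nonSensitivePart P D)) {D | D i = y} O ≤
      ENNReal.ofReal (Real.exp τ) * (θ i x / θ i y) := by
  have hone : 1 ≤ ENNReal.ofReal (Real.exp τ) := by
    have := ENNReal.le_ofReal_exp_mul_of_ofReal_exp_neg_mul_le (hA 0 x Set.univ .univ).1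
    simpa using this
  have hstep : ∀ D : Fin n → T, D i = x → A (nonSensitivePart P D) O ≤
      ENNReal.ofReal (Real.exp τ) * A (nonSensitivePart P (Function.update D i y)) O := by
    intro D hD
    rw [nonSensitivePart_update P D i (hD ▸ hx) y]
    split_ifs
    · exact ENNReal.le_ofReal_exp_mul_of_ofReal_exp_neg_mul_le (hA _ y O hO).1
    · exact le_mul_of_one_le_left' hone
  have hjoint := jointProb_mul_le θ (fun D => A (nonSensitivePart P D)) i x y O _ hstep
  refine ENNReal.div_le_of_le_mul ?_
  rw [condProb, condProb, ← mul_div_assoc]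
  gcongr
  rw [← mul_div_assoc, ← ENNReal.mul_div_right_comm,
    ENNReal.le_div_iff_mul_le (.inl hθy.ne') (.inl ((θ i).apply_ne_top y))]
  exact hjoint
end

section
/- The OsdpLaplace mechanism with scale λ = 1/ε satisfies (P, ε)-one-sided differential privacy. Concretely: let Z = (Z₁, …, Z_d) be i.i.d. one-sided Laplace random variables with scale 1/ε (each Z_i has density ε·e^{ε z} for z ≤ 0 and 0 for z > 0). Then for all vectors x, x' ∈ ℝ^d with x_i ≤ x'_i for all i and ‖x' − x‖₁ ≤ 1, and every measurable set O ⊆ ℝ^d, Pr[x + Z ∈ O] ≤ e^{ε} · Pr[x' + Z ∈ O]. Since for any database D and any one-sided P-neighbor D' of D, the histograms x, x' of the non-sensitive records of D and D' respectively satisfy x_i ≤ x'_i for all i and ‖x' − x‖₁ ≤ 1, the mechanism that outputs the non-sensitive histogram of its input plus Z satisfies (P, ε)-OSDP. -/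
open MeasureTheory Real

/-- The one-sided Laplace distribution with scale `1/ε`: density
`ε·e^{ε z}` for `z ≤ 0` and `0` for `z > 0`. -/
noncomputable def oneSidedLap (ε : ℝ) : Measure ℝ :=
  volume.withDensity fun z =>
    ENNReal.ofReal (if z ≤ 0 then ε * Real.exp (ε * z) else 0)

/-- The histogram of a database. -/
def hist {T : Type*} {d : ℕ} (binOf : T → Fin d) (D : Multiset T)
    (b : Fin d) : ℕ :=
  (D.filter fun r => binOf r = b).card

/-- Finite products of measures are monotone in each factor, up to constants. -/
theorem MeasureTheory.Measure.pi_le_smul_pi {ι : Type*} [Fintype ι] {α : ι → Type*}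
    [∀ i, MeasurableSpace (α i)] {μ ν : ∀ i, Measure (α i)}
    [∀ i, SigmaFinite (μ i)] [∀ i, SigmaFinite (ν i)] (c : ι → NNReal)
    (h : ∀ i, μ i ≤ c i • ν i) :
    Measure.pi μ ≤ (∏ i, c i) • Measure.pi ν := by
  have hpi : Measure.pi (fun i => c i • ν i) = (∏ i, c i) • Measure.pi ν := by
    refine Measure.pi_eq fun s _ => ?_
    simp only [Measure.smul_apply, Measure.pi_pi, ENNReal.smul_def, smul_eq_mul,
      Finset.prod_mul_distrib, ENNReal.ofNNReal_finsetProd]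
  rw [← hpi]
  refine Measure.le_iff.2 fun s hs => ?_
  rw [Measure.pi_def (fun i => c i • ν i), toMeasure_apply _ _ hs]
  refine (OuterMeasure.le_pi (n := (Measure.pi μ).toOuterMeasure)).2 (fun t _ => ?_) s
  calc Measure.pi μ (Set.univ.pi t) = ∏ i, μ i (t i) := Measure.pi_pi μ t
    _ ≤ _ := Finset.prod_le_prod' fun i _ => h i (t i)

theorem map_const_add_withDensity_volume (f : ℝ → ENNReal) (x : ℝ) :
    (volume.withDensity f).map (fun z => x + z) = volume.withDensity fun w => f (w - x) := by
  ext s hs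
  have hx : Measurable fun z : ℝ => x + z := measurable_const_add x
  rw [Measure.map_apply hx hs, withDensity_apply _ (hx hs), withDensity_apply _ hs,
    ← lintegral_indicator (hx hs), ← lintegral_indicator hs,
    ← lintegral_add_left_eq_self (s.indicator fun w => f (w - x)) x]
  refine lintegral_congr fun z => ?_
  simp only [Set.indicator, add_sub_cancel_left]
  rfl

instance oneSidedLap.instSigmaFinite (ε : ℝ) : SigmaFinite (oneSidedLap ε) := by
  unfold oneSidedLap
  infer_instance

theorem map_const_add_oneSidedLap_le {ε x x' : ℝ} (hε : 0 < ε) (h : x ≤ x') :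
    (oneSidedLap ε).map (fun z => x + z) ≤
      (exp (ε * (x' - x))).toNNReal • (oneSidedLap ε).map (fun z => x' + z) := by
  have hmeas : Measurable fun w =>
      ENNReal.ofReal (if w - x' ≤ 0 then ε * exp (ε * (w - x')) else 0) :=
    ENNReal.measurable_ofReal.comp (Measurable.ite
      (measurableSet_le (by fun_prop) measurable_const) (by fun_prop) measurable_const)
  rw [oneSidedLap, map_const_add_withDensity_volume, map_const_add_withDensity_volume,
    ENNReal.smul_def, ← withDensity_smul _ hmeas]
  refine withDensity_mono (Filter.Eventually.of_forall fun w => ?_)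
  change _ ≤ ENNReal.ofReal _ * ENNReal.ofReal _
  rw [← ENNReal.ofReal_mul (exp_pos _).le]
  refine ENNReal.ofReal_le_ofReal ?_
  by_cases hw : w - x ≤ 0
  · rw [if_pos hw, if_pos (by linarith), mul_left_comm, ← exp_add]
    exact le_of_eq (by ring_nf)
  · rw [if_neg hw]
    positivity

theorem pi_oneSidedLap_preimage_add_le {ι : Type*} [Fintype ι] {ε : ℝ} (hε : 0 < ε)
    {x x' : ι → ℝ} (hle : ∀ i, x i ≤ x' i) (hsum : (∑ i, |x' i - x i|) ≤ 1)
    {O : Set (ι → ℝ)} (hO : MeasurableSet O) :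
    (Measure.pi fun _ : ι => oneSidedLap ε) ((fun z i => x i + z i) ⁻¹' O) ≤
      ENNReal.ofReal (exp ε) *
        (Measure.pi fun _ : ι => oneSidedLap ε) ((fun z i => x' i + z i) ⁻¹' O) := by
  have hσ : ∀ y : ℝ, SigmaFinite ((oneSidedLap ε).map fun z => y + z) := fun y =>
    (MeasurableEquiv.addLeft y).sigmaFinite_map
  have hmap : ∀ y : ι → ℝ, (Measure.pi fun _ : ι => oneSidedLap ε) ((fun z i => y i + z i) ⁻¹' O) =
      (Measure.pi fun i => (oneSidedLap ε).map fun z => y i + z) O := fun y => by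
    rw [← Measure.pi_map_pi fun i => (measurable_const_add (y i)).aemeasurable,
      Measure.map_apply (by fun_prop) hO]
  rw [hmap, hmap]
  refine (Measure.pi_le_smul_pi _ (fun i => map_const_add_oneSidedLap_le hε (hle i)) O).trans ?_
  rw [Measure.smul_apply, ENNReal.smul_def, smul_eq_mul]
  refine mul_le_mul_left ?_ _
  rw [← Real.toNNReal_prod_of_nonneg fun i _ => (exp_pos _).le, ← exp_sum, ← Finset.mul_sum]
  refine ENNReal.ofReal_le_ofReal (exp_le_exp.2 ?_)
  have hs : ∑ i, (x' i - x i) ≤ 1 :=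
    (Finset.sum_le_sum fun i _ => le_abs_self _).trans hsum
  nlinarith

theorem hist_cons {T : Type*} {d : ℕ} (binOf : T → Fin d) (r : T) (D : Multiset T) (b : Fin d) :
    hist binOf (r ::ₘ D) b = (if binOf r = b then 1 else 0) + hist binOf D b := by
  unfold hist
  split_ifs with h <;> simp [h, add_comm]

/-- Replacing a sensitive record adds at most one record to the non-sensitive ones. -/
theorem OneSidedNeighbor.filter_nonsensitive {T : Type*} [DecidableEq T] {P : T → ℕ}
    {D D' : Multiset T} (h : OneSidedNeighbor P D D') :
    (D'.filter fun r => P r = 1) = (D.filter fun r => P r = 1) ∨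
      ∃ r', (D'.filter fun r => P r = 1) = r' ::ₘ D.filter fun r => P r = 1 := by
  obtain ⟨r, hr, hP, r', -, rfl⟩ := h
  have hD : ((D.erase r).filter fun r => P r = 1) = D.filter fun r => P r = 1 := by
    conv_rhs => rw [← Multiset.cons_erase hr]
    rw [Multiset.filter_cons_of_neg _ (by simp [hP])]
  by_cases h' : P r' = 1
  · exact Or.inr ⟨r', by rw [Multiset.filter_cons_of_pos (p := fun r => P r = 1) _ h', hD]⟩
  · exact Or.inl (by rw [Multiset.filter_cons_of_neg (p := fun r => P r = 1) _ h', hD])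

/-- The `OsdpLaplace` mechanism with scale `1/ε` satisfies `(P, ε)`-OSDP.
Writing `Z = (Z₁, …, Z_d)` for a vector of i.i.d. one-sided Laplace noise
variables with scale `1/ε`:
(i) for all `x ≤ x'` (componentwise) with `‖x' − x‖₁ ≤ 1` and all measurable
`O`, `Pr[x + Z ∈ O] ≤ e^ε · Pr[x' + Z ∈ O]`; and
(ii) the mechanism that outputs the histogram of the non-sensitive records of
its input plus `Z` satisfies `(P, ε)`-OSDP. -/
theorem osdpLaplace_satisfies_osdp {T : Type*} [DecidableEq T] {d : ℕ}
    (binOf : T → Fin d) (P : T → ℕ) (ε : ℝ) (hε : 0 < ε) :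
    (∀ x x' : Fin d → ℝ, (∀ i, x i ≤ x' i) → (∑ i, |x' i - x i|) ≤ 1 →
      ∀ O : Set (Fin d → ℝ), MeasurableSet O →
        (Measure.pi fun _ : Fin d => oneSidedLap ε)
            ((fun z i => x i + z i) ⁻¹' O) ≤
          ENNReal.ofReal (Real.exp ε) *
            (Measure.pi fun _ : Fin d => oneSidedLap ε)
              ((fun z i => x' i + z i) ⁻¹' O)) ∧
    OSDP P ε (fun D =>
      (Measure.pi fun _ : Fin d => oneSidedLap ε).map
        (fun z i => (hist binOf (D.filter fun r => P r = 1) i : ℝ) + z i)) := by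
  refine ⟨fun x x' hle hsum O hO => pi_oneSidedLap_preimage_add_le hε hle hsum hO,
    fun D D' hDD' O hO => ?_⟩
  have hmeas : ∀ y : Fin d → ℝ, Measurable fun (z : Fin d → ℝ) i => y i + z i := fun y => by
    fun_prop
  rw [Measure.map_apply (hmeas _) hO, Measure.map_apply (hmeas _) hO]
  apply pi_oneSidedLap_preimage_add_le hε _ _ hO
  · intro i
    rcases hDD'.filter_nonsensitive with h | ⟨r', h⟩
    · rw [h]
    · rw [h, hist_cons]
      exact Nat.cast_le.2 (Nat.le_add_left _ _)
  · rcases hDD'.filter_nonsensitive with h | ⟨r', h⟩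
    · simp [h]
    · simp [h, hist_cons, apply_ite abs]
end

section
/- The OsdpLaplace mechanism introduces noise with 1/8 the variance of the ε-differentially private Laplace mechanism: if Z is a one-sided Laplace random variable with scale 1/ε (density ε·e^{ε z} for z ≤ 0), then Var(Z) = 1/ε², while a Laplace random variable L with mean 0 and scale 2/ε (density (ε/4)·e^{−ε|t|/2}) has Var(L) = 8/ε²; hence Var(Z) = (1/8)·Var(L). -/
open MeasureTheory Real

/-- The Laplace distribution with mean `0` and scale `2/ε`: density
`(ε/4)·e^{−(ε/2)|t|}`. -/
noncomputable def lapMeasure (ε : ℝ) : Measure ℝ :=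
  volume.withDensity fun t =>
    ENNReal.ofReal ((ε / 4) * Real.exp (-(ε / 2) * |t|))

open ProbabilityTheory in
lemma variance_id_withDensity_ofReal {f : ℝ → ℝ} (hf : Measurable f) (h0 : ∀ x, 0 ≤ f x)
    (h1 : ∫ x, f x = 1) (h2 : Integrable fun x => f x * x ^ 2) :
    Var[id; volume.withDensity fun x => ENNReal.ofReal (f x)] =
      (∫ x, f x * x ^ 2) - (∫ x, f x * x) ^ 2 := by
  have hm : Measurable fun x => ENNReal.ofReal (f x) := hf.ennreal_ofReal
  have hlt : ∀ᵐ x : ℝ, ENNReal.ofReal (f x) < ⊤ := by simp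
  have hint : Integrable f := Integrable.of_integral_ne_zero (by rw [h1]; exact one_ne_zero)
  have hprob : IsProbabilityMeasure (volume.withDensity fun x => ENNReal.ofReal (f x)) := by
    refine ⟨?_⟩
    rw [withDensity_apply _ MeasurableSet.univ, setLIntegral_univ,
      ← ofReal_integral_eq_lintegral_ofReal hint (ae_of_all _ h0), h1, ENNReal.ofReal_one]
  have hL : MemLp id 2 (volume.withDensity fun x => ENNReal.ofReal (f x)) := by
    rw [memLp_two_iff_integrable_sq measurable_id.aestronglyMeasurable,
      integrable_withDensity_iff_integrable_smul' hm hlt]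
    simpa [ENNReal.toReal_ofReal, h0] using h2
  rw [variance_eq_sub hL, integral_withDensity_eq_integral_toReal_smul hm hlt,
    integral_withDensity_eq_integral_toReal_smul hm hlt]
  simp [ENNReal.toReal_ofReal, h0]

lemma integral_pow_mul_exp_neg_mul_Ioi (n : ℕ) {r : ℝ} (hr : 0 < r) :
    ∫ x in Set.Ioi (0 : ℝ), x ^ n * Real.exp (-(r * x)) = n.factorial / r ^ (n + 1) := by
  have h := Real.integral_rpow_mul_exp_neg_mul_Ioi (a := n + 1) (by positivity) hr
  simp only [Real.Gamma_nat_eq_factorial, add_sub_cancel_right, Real.rpow_natCast] at h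
  rw [h, ← Nat.cast_add_one, Real.rpow_natCast, one_div_pow, one_div_mul_eq_div]

lemma integrableOn_pow_mul_exp_neg_mul_Ioi (n : ℕ) {r : ℝ} (hr : 0 < r) :
    IntegrableOn (fun x => x ^ n * Real.exp (-(r * x))) (Set.Ioi 0) := by
  refine Integrable.of_integral_ne_zero ?_
  rw [integral_pow_mul_exp_neg_mul_Ioi n hr]
  positivity

lemma integral_pow_mul_exp_mul_Iic (n : ℕ) {r : ℝ} (hr : 0 < r) :
    ∫ x in Set.Iic (0 : ℝ), x ^ n * Real.exp (r * x) =
      (-1) ^ n * (n.factorial / r ^ (n + 1)) := by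
  rw [← integral_pow_mul_exp_neg_mul_Ioi n hr, ← integral_const_mul]
  have h := integral_comp_neg_Ioi (0 : ℝ) fun x => x ^ n * Real.exp (r * x)
  rw [neg_zero] at h
  rw [← h]
  congr 1 with x
  rw [neg_pow, mul_neg, mul_assoc]

lemma integrableOn_pow_mul_exp_mul_Iic (n : ℕ) {r : ℝ} (hr : 0 < r) :
    IntegrableOn (fun x => x ^ n * Real.exp (r * x)) (Set.Iic 0) := by
  refine Integrable.of_integral_ne_zero ?_
  rw [integral_pow_mul_exp_mul_Iic n hr]
  have : ((-1 : ℝ)) ^ n ≠ 0 := pow_ne_zero _ (by norm_num)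
  positivity

lemma integrable_pow_mul_exp_neg_mul_abs (n : ℕ) {r : ℝ} (hr : 0 < r) :
    Integrable fun x : ℝ => x ^ n * Real.exp (-r * |x|) := by
  rw [← integrableOn_univ, ← Set.Iic_union_Ioi (a := (0 : ℝ))]
  refine IntegrableOn.union ?_ ?_
  · refine (integrableOn_pow_mul_exp_mul_Iic n hr).congr_fun (fun x hx => ?_) measurableSet_Iic
    simp [abs_of_nonpos (Set.mem_Iic.1 hx)]
  · refine (integrableOn_pow_mul_exp_neg_mul_Ioi n hr).congr_fun (fun x hx => ?_) measurableSet_Ioi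
    simp [abs_of_pos (Set.mem_Ioi.1 hx)]

lemma integral_pow_mul_exp_neg_mul_abs (n : ℕ) {r : ℝ} (hr : 0 < r) :
    ∫ x : ℝ, x ^ n * Real.exp (-r * |x|) = ((-1) ^ n + 1) * (n.factorial / r ^ (n + 1)) := by
  have hi := integrable_pow_mul_exp_neg_mul_abs n hr
  rw [← intervalIntegral.integral_Iic_add_Ioi (b := 0) hi.integrableOn hi.integrableOn, add_mul,
    one_mul, ← integral_pow_mul_exp_mul_Iic n hr, ← integral_pow_mul_exp_neg_mul_Ioi n hr]
  congr 1
  · refine setIntegral_congr_fun measurableSet_Iic fun x hx => ?_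
    simp [abs_of_nonpos (Set.mem_Iic.1 hx)]
  · refine setIntegral_congr_fun measurableSet_Ioi fun x hx => ?_
    simp [abs_of_pos (Set.mem_Ioi.1 hx)]

lemma variance_oneSidedLap {ε : ℝ} (hε : 0 < ε) :
    ProbabilityTheory.variance id (oneSidedLap ε) = 1 / ε ^ 2 := by
  have hd (n : ℕ) : (fun x : ℝ => (if x ≤ 0 then ε * Real.exp (ε * x) else 0) * x ^ n) =
      (Set.Iic 0).indicator fun x => ε * (x ^ n * Real.exp (ε * x)) := by
    ext x
    by_cases hx : x ≤ 0
    · simp only [hx, if_true, Set.indicator, Set.mem_Iic]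
      ring
    · simp [hx]
  have hm (n : ℕ) : ∫ x : ℝ, (if x ≤ 0 then ε * Real.exp (ε * x) else 0) * x ^ n =
      ε * ((-1) ^ n * (n.factorial / ε ^ (n + 1))) := by
    rw [hd, integral_indicator measurableSet_Iic, integral_const_mul,
      integral_pow_mul_exp_mul_Iic n hε]
  have h0 := hm 0
  have h1 := hm 1
  simp only [pow_zero, mul_one, pow_one] at h0 h1
  rw [oneSidedLap, variance_id_withDensity_ofReal, hm 2, h1]
  · simp
    field_simp
    norm_num
  · exact Measurable.ite measurableSet_Iic (by fun_prop) measurable_const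
  · intro x
    split_ifs <;> positivity
  · rw [h0]
    simp [hε.ne']
  · rw [hd, integrable_indicator_iff measurableSet_Iic]
    exact (integrableOn_pow_mul_exp_mul_Iic 2 hε).const_mul ε

lemma variance_lapMeasure {ε : ℝ} (hε : 0 < ε) :
    ProbabilityTheory.variance id (lapMeasure ε) = 8 / ε ^ 2 := by
  have hd (n : ℕ) (x : ℝ) : ε / 4 * Real.exp (-(ε / 2) * |x|) * x ^ n =
      ε / 4 * (x ^ n * Real.exp (-(ε / 2) * |x|)) := by ring
  have hm (n : ℕ) : ∫ x : ℝ, ε / 4 * Real.exp (-(ε / 2) * |x|) * x ^ n =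
      ε / 4 * (((-1) ^ n + 1) * (n.factorial / (ε / 2) ^ (n + 1))) := by
    simp_rw [hd]
    rw [integral_const_mul, integral_pow_mul_exp_neg_mul_abs n (half_pos hε)]
  have h0 := hm 0
  have h1 := hm 1
  simp only [pow_zero, mul_one, pow_one] at h0 h1
  rw [lapMeasure, variance_id_withDensity_ofReal, hm 2, h1]
  · simp
    field_simp
    norm_num
  · fun_prop
  · intro x
    positivity
  · rw [h0]
    simp
    field_simp
    norm_num
  · simp_rw [hd]
    exact (integrable_pow_mul_exp_neg_mul_abs 2 (half_pos hε)).const_mul _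

/-- The `OsdpLaplace` noise has `1/8` the variance of the `ε`-DP Laplace
mechanism's noise: the one-sided Laplace distribution with scale `1/ε` has
variance `1/ε²`, the Laplace distribution with mean `0` and scale `2/ε` has
variance `8/ε²`, and hence the former is `1/8` of the latter. -/
theorem oneSidedLap_variance_eighth (ε : ℝ) (hε : 0 < ε) :
    ProbabilityTheory.variance id (oneSidedLap ε) = 1 / ε ^ 2 ∧
    ProbabilityTheory.variance id (lapMeasure ε) = 8 / ε ^ 2 ∧
    ProbabilityTheory.variance id (oneSidedLap ε) =
      (1 / 8) * ProbabilityTheory.variance id (lapMeasure ε) := by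
  refine ⟨variance_oneSidedLap hε, variance_lapMeasure hε, ?_⟩
  rw [variance_oneSidedLap hε, variance_lapMeasure hε]
  ring
end

section
/- Hybrid composition with post-processing (the DAWAz privacy guarantee): let 0 < ρ < 1, let M₁ be a mechanism satisfying (P, ρ·ε)-one-sided differential privacy, let M₂ be a mechanism satisfying (1 − ρ)·ε-differential privacy, and let g be any measurable (deterministic) function of the pair of outputs. Then the mechanism D ↦ g(M₁(D), M₂(D)), where M₁ and M₂ are run independently on D, satisfies (P, ε)-one-sided differential privacy. -/
open MeasureTheory Real

/-- `D'` is a DP-neighbor of `D`: some record `r ∈ D` is replaced by a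
different record `r'`. -/
def DPNeighbor {T : Type*} [DecidableEq T] (D D' : Multiset T) : Prop :=
  ∃ r ∈ D, ∃ r', r' ≠ r ∧ D' = r' ::ₘ D.erase r

/-- `ε`-differential privacy. -/
def DP {T : Type*} [DecidableEq T] {Ω : Type*} [MeasurableSpace Ω]
    (ε : ℝ) (M : Multiset T → Measure Ω) : Prop :=
  ∀ D D', DPNeighbor D D' → ∀ O : Set Ω, MeasurableSet O →
    M D O ≤ ENNReal.ofReal (Real.exp ε) * M D' O

/-- Hybrid composition with post-processing (the `DAWAz` privacy guarantee):
if `M₁` satisfies `(P, ρ·ε)`-OSDP, `M₂` satisfies `(1−ρ)·ε`-DP (both producing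
probability distributions), and `g` is a measurable deterministic function of
the pair of outputs, then the mechanism `D ↦ g(M₁(D), M₂(D))` — with `M₁` and
`M₂` run independently on `D`, i.e. with output distribution the image under
`g` of the product measure — satisfies `(P, ε)`-OSDP. -/
theorem osdp_hybrid_composition {T : Type*} [DecidableEq T]
    {Ω₁ Ω₂ Ω : Type*} [MeasurableSpace Ω₁] [MeasurableSpace Ω₂]
    [MeasurableSpace Ω]
    (P : T → ℕ) (ε ρ : ℝ) (hρ₀ : 0 < ρ) (hρ₁ : ρ < 1)
    (M₁ : Multiset T → Measure Ω₁) (M₂ : Multiset T → Measure Ω₂)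
    (hprob₁ : ∀ D, IsProbabilityMeasure (M₁ D))
    (hprob₂ : ∀ D, IsProbabilityMeasure (M₂ D))
    (hM₁ : OSDP P (ρ * ε) M₁) (hM₂ : DP ((1 - ρ) * ε) M₂)
    (g : Ω₁ × Ω₂ → Ω) (hg : Measurable g) :
    OSDP P ε (fun D => ((M₁ D).prod (M₂ D)).map g) := by
  rintro D D' ⟨r, hr, hPr, r', hne, hD'⟩ O hO
  have h₁ : M₁ D ≤ ENNReal.ofReal (exp (ρ * ε)) • M₁ D' :=
    Measure.le_iff.2 fun s hs => hM₁ D D' ⟨r, hr, hPr, r', hne, hD'⟩ s hs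
  have h₂ : M₂ D ≤ ENNReal.ofReal (exp ((1 - ρ) * ε)) • M₂ D' :=
    Measure.le_iff.2 fun s hs => hM₂ D D' ⟨r, hr, r', hne, hD'⟩ s hs
  have hexp : ENNReal.ofReal (exp ε) =
      ENNReal.ofReal (exp (ρ * ε)) * ENNReal.ofReal (exp ((1 - ρ) * ε)) := by
    rw [← ENNReal.ofReal_mul (exp_pos _).le, ← exp_add]
    ring_nf
  have hS : MeasurableSet (g ⁻¹' O) := hg hO
  simp only [Measure.map_apply hg hO, Measure.prod_apply hS]
  calc ∫⁻ x, M₂ D (Prod.mk x ⁻¹' (g ⁻¹' O)) ∂M₁ D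
      ≤ ∫⁻ x, ENNReal.ofReal (exp ((1 - ρ) * ε)) * M₂ D' (Prod.mk x ⁻¹' (g ⁻¹' O))
          ∂(ENNReal.ofReal (exp (ρ * ε)) • M₁ D') :=
        lintegral_mono' h₁ fun x => h₂ _
    _ = ENNReal.ofReal (exp ε) * ∫⁻ x, M₂ D' (Prod.mk x ⁻¹' (g ⁻¹' O)) ∂M₁ D' := by
        rw [lintegral_smul_measure, lintegral_const_mul' _ _ ENNReal.ofReal_ne_top, hexp,
          smul_eq_mul, mul_assoc]
end
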